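/- Let a, μ ∈ ℝ and σ > 0, and let X be a real-valued random variable with law N(μ, σ²). Then E[max(a − X, 0)] = (a − μ)·Φ(Z) + σ·φ(Z), where Z = (a − μ)/σ. (This is the closed form of the expected improvement acquisition function EI(x) with incumbent value a = f(x⁺).) -/

import Mathlib

open MeasureTheory ProbabilityTheory Real

/-- The density of the standard normal distribution on `ℝ`. -/
noncomputable def stdNormalPDF (z : ℝ) : ℝ :=
  (Real.sqrt (2 * Real.pi))⁻¹ * Real.exp (-z ^ 2 / 2)

/-- The cumulative distribution function of the standard normal distribution. -/
noncomputable def stdNormalCDF (t : ℝ) : ℝ :=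
  ∫ z in Set.Iic t, stdNormalPDF z

lemma stdNormalPDF_eq_gaussianPDFReal : stdNormalPDF = gaussianPDFReal 0 1 := by
  ext z
  simp [stdNormalPDF, gaussianPDFReal]

lemma integrable_stdNormalPDF : Integrable stdNormalPDF :=
  stdNormalPDF_eq_gaussianPDFReal ▸ integrable_gaussianPDFReal 0 1

lemma integrable_mul_stdNormalPDF : Integrable fun z ↦ z * stdNormalPDF z := by
  refine ((integrable_mul_exp_neg_mul_sq (b := 1 / 2) (by norm_num)).const_mul
    (√(2 * π))⁻¹).congr (.of_forall fun z ↦ ?_)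
  simp only [stdNormalPDF]
  ring_nf

lemma hasDerivAt_stdNormalPDF (z : ℝ) : HasDerivAt stdNormalPDF (-(z * stdNormalPDF z)) z := by
  have h : HasDerivAt (fun z : ℝ ↦ -z ^ 2 / 2) (-z) z := by
    refine ((hasDerivAt_pow 2 z).neg.div_const 2).congr_deriv ?_
    norm_num
    ring
  refine (h.exp.const_mul (√(2 * π))⁻¹).congr_deriv ?_
  simp only [stdNormalPDF]
  ring

/-- The truncated first moment of the standard normal distribution. -/
lemma integral_Iic_mul_stdNormalPDF (t : ℝ) :
    ∫ z in Set.Iic t, z * stdNormalPDF z = -stdNormalPDF t := by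
  have hderiv : ∀ z ∈ Set.Iic t, HasDerivAt stdNormalPDF (-(z * stdNormalPDF z)) z :=
    fun z _ ↦ hasDerivAt_stdNormalPDF z
  have hlim := tendsto_zero_of_hasDerivAt_of_integrableOn_Iic hderiv
    integrable_mul_stdNormalPDF.neg.integrableOn integrable_stdNormalPDF.integrableOn
  have h := integral_Iic_of_hasDerivAt_of_tendsto' hderiv
    integrable_mul_stdNormalPDF.neg.integrableOn hlim
  rw [integral_neg] at h
  linarith

/-- The standard normal expectation of the positive part of a decreasing affine function. -/
lemma integral_max_sub_mul_gaussianReal (b : ℝ) {σ : ℝ} (hσ : 0 < σ) :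
    ∫ z, max (b - σ * z) 0 ∂gaussianReal 0 1 =
      b * stdNormalCDF (b / σ) + σ * stdNormalPDF (b / σ) := by
  have hind : (fun z ↦ gaussianPDFReal 0 1 z • max (b - σ * z) 0) =
      (Set.Iic (b / σ)).indicator
        fun z ↦ b * stdNormalPDF z - σ * (z * stdNormalPDF z) := by
    ext z
    rw [← stdNormalPDF_eq_gaussianPDFReal, smul_eq_mul]
    by_cases hz : z ≤ b / σ
    · rw [Set.indicator_of_mem (Set.mem_Iic.2 hz), max_eq_left]
      · ring
      · linarith [(le_div_iff₀' hσ).1 hz]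
    · rw [Set.indicator_of_notMem (by simpa using hz), max_eq_right, mul_zero]
      linarith [(div_lt_iff₀' hσ).1 (not_le.1 hz)]
  rw [integral_gaussianReal_eq_integral_smul one_ne_zero, hind,
    integral_indicator measurableSet_Iic,
    integral_sub (integrable_stdNormalPDF.const_mul b).integrableOn
      (integrable_mul_stdNormalPDF.const_mul σ).integrableOn,
    integral_const_mul, integral_const_mul, integral_Iic_mul_stdNormalPDF, stdNormalCDF]
  ring

/-- Closed form of the expected improvement: for `X ~ N(μ, σ²)` with `σ > 0` and incumbent
value `a`, `E[max (a - X) 0] = (a - μ) Φ(Z) + σ φ(Z)` with `Z = (a - μ)/σ`. -/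
theorem expected_improvement_closed_form
    {Ω : Type*} [MeasurableSpace Ω] (P : Measure Ω) [IsProbabilityMeasure P]
    (X : Ω → ℝ) (hX : Measurable X) (a μ σ : ℝ) (hσ : 0 < σ)
    (hlaw : P.map X = gaussianReal μ (⟨σ ^ 2, sq_nonneg σ⟩ : NNReal)) :
    ∫ ω, max (a - X ω) 0 ∂P =
      (a - μ) * stdNormalCDF ((a - μ) / σ) + σ * stdNormalPDF ((a - μ) / σ) := by
  have hmap : P.map X = (gaussianReal 0 1).map fun z ↦ μ + σ * z := by
    rw [hlaw, ← Function.comp_def (fun x ↦ μ + x) fun z ↦ σ * z,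
      ← Measure.map_map (by fun_prop) (by fun_prop), gaussianReal_map_const_mul,
      gaussianReal_map_const_add]
    simp only [mul_zero, zero_add, mul_one]
    rfl
  rw [← integral_map (f := fun x ↦ max (a - x) 0) hX.aemeasurable
      (by fun_prop), hmap, integral_map (by fun_prop) (by fun_prop),
    ← integral_max_sub_mul_gaussianReal (a - μ) hσ]
  simp only [sub_sub]
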